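/- arXiv:1407.3251 — 2 statements merged into one kernel-verified Lean document; each statement's English description precedes it below -/
import Mathlib

section
/- Let V ⊆ ℝ^{n+1} be an open set, h : V → ℝ a smooth function positively homogeneous of degree k ≠ 0, and U ⊆ V an open subset such that the closure of H := {x ∈ U : h(x) = 1} in ℝ^{n+1} is contained in V. Assume that for every p ∈ H the restriction of D²h_p to ker Dh_p is definite. Let H₀ be a connected component of H. Then H₀ is a closed subset of ℝ^{n+1} if and only if for every T ∈ (0, ∞] every smooth curve γ : [0, T) → H₀ that is not contained in any compact subset of H₀ has infinite Euclidean length ∫₀^T |γ'(t)| dt = ∞. -/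
open Set MeasureTheory ENNReal

open Filter Topology

section RadialProjection

variable {E : Type*} [NormedAddCommGroup E] [NormedSpace ℝ E]

/-- The projection along rays onto the level set `{h = 1}` of a positively homogeneous
function `h` of degree `k`. -/
noncomputable def radialProj (h : E → ℝ) (k : ℝ) (y : E) : E := (h y) ^ (-k⁻¹) • y

lemma radialProj_of_eq_one {h : E → ℝ} {k : ℝ} {y : E} (hy : h y = 1) :
    radialProj h k y = y := by
  simp [radialProj, hy]

/-- Euler's relation on a convex open set integrates to homogeneity along rays. -/
lemma rpow_mul_eq_of_euler {B : Set E} (hBo : IsOpen B) (hBc : Convex ℝ B) {k : ℝ}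
    {h : E → ℝ} (hd : DifferentiableOn ℝ h B) (heuler : ∀ x ∈ B, fderiv ℝ h x x = k * h x)
    {y : E} (hy : y ∈ B) {a : ℝ} (ha : 0 < a) (hay : a • y ∈ B) :
    a ^ (-k) * h (a • y) = h y := by
  have hSo : IsOpen ((fun s : ℝ => s • y) ⁻¹' B ∩ Ioi 0) :=
    (hBo.preimage (by fun_prop)).inter isOpen_Ioi
  have hSc : Convex ℝ ((fun s : ℝ => s • y) ⁻¹' B ∩ Ioi 0) :=
    (hBc.linear_preimage (LinearMap.toSpanSingleton ℝ E y)).inter (convex_Ioi 0)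
  have hder : ∀ s ∈ (fun s : ℝ => s • y) ⁻¹' B ∩ Ioi 0,
      HasDerivAt (fun s : ℝ => s ^ (-k) * h (s • y)) 0 s := by
    rintro s ⟨hsB, hs0 : 0 < s⟩
    have h1 : HasDerivAt (fun s : ℝ => s • y) y s := by
      simpa using (hasDerivAt_id s).smul_const y
    have h2 : HasFDerivAt h (fderiv ℝ h (s • y)) (s • y) :=
      ((hd _ hsB).differentiableAt (hBo.mem_nhds hsB)).hasFDerivAt
    have h3 := (Real.hasDerivAt_rpow_const (p := -k) (Or.inl hs0.ne')).mul
      (h2.comp_hasDerivAt s h1)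
    refine h3.congr_deriv ?_
    have h4 : s * fderiv ℝ h (s • y) y = k * h (s • y) := by
      simpa using heuler _ hsB
    rw [Real.rpow_sub_one hs0.ne']
    have h5 : fderiv ℝ h (s • y) y = k * h (s • y) / s := by
      rw [← h4]; field_simp
    simp only [h5, Function.comp]
    ring
  have := hSo.is_const_of_deriv_eq_zero hSc.isPreconnected
    (fun s hs => (hder s hs).differentiableAt.differentiableWithinAt)
    (fun s hs => (hder s hs).deriv) (x := a) (y := 1) ⟨hay, ha⟩ ⟨by simpa using hy, mem_Ioi.2 one_pos⟩
  simpa using this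

/-- Near a point of `{h = 1}`, the radial projection is a smooth retraction onto `{h = 1}`. -/
lemma exists_ball_radialProj {V : Set E} (hV : IsOpen V) {k : ℝ} (hk : k ≠ 0) {h : E → ℝ}
    (hsmooth : ContDiffOn ℝ (⊤ : ℕ∞) h V) (heuler : ∀ x ∈ V, fderiv ℝ h x x = k * h x)
    {p : E} (hpV : p ∈ V) (hp : h p = 1) {W : Set E} (hW : W ∈ 𝓝 p) :
    ∃ r > 0, ContDiffOn ℝ (⊤ : ℕ∞) (radialProj h k) (Metric.ball p r) ∧
      ∀ y ∈ Metric.ball p r, h (radialProj h k y) = 1 ∧ radialProj h k y ∈ W := by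
  have hcont : ContinuousAt h p := hsmooth.continuousOn.continuousAt (hV.mem_nhds hpV)
  have hpos : ∀ᶠ y in 𝓝 p, 0 < h y := hcont.eventually (lt_mem_nhds (by simp [hp]))
  obtain ⟨R, hR, hRsub⟩ := Metric.eventually_nhds_iff_ball.1
    ((hV.eventually_mem hpV).and (hpos.and hW))
  have hcontπ : ContinuousAt (radialProj h k) p :=
    (hcont.rpow_const (Or.inl (by simp [hp]))).smul continuousAt_id
  have hmem : ∀ᶠ y in 𝓝 p, radialProj h k y ∈ Metric.ball p R := by
    apply hcontπ.eventually_mem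
    rw [radialProj_of_eq_one hp]
    exact Metric.ball_mem_nhds _ hR
  obtain ⟨r, hr, hrsub⟩ := Metric.eventually_nhds_iff_ball.1
    ((Metric.isOpen_ball.eventually_mem (Metric.mem_ball_self hR)).and hmem)
  refine ⟨r, hr, ?_, fun y hy => ?_⟩
  · refine ContDiffOn.smul (ContDiffOn.rpow_const_of_ne ?_ ?_) contDiffOn_id
    · exact hsmooth.mono fun y hy => (hRsub y (hrsub y hy).1).1
    · exact fun y hy => (hRsub y (hrsub y hy).1).2.1.ne'
  · obtain ⟨hyR, hyπ⟩ := hrsub y hy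
    have hy0 := (hRsub y hyR).2.1
    refine ⟨?_, (hRsub _ hyπ).2.2⟩
    have := rpow_mul_eq_of_euler Metric.isOpen_ball (convex_ball p R)
      ((hsmooth.differentiableOn (by simp)).mono fun y hy => (hRsub y hy).1)
      (fun x hx => heuler x (hRsub x hx).1) hyR (Real.rpow_pos_of_pos hy0 (-k⁻¹)) hyπ
    rw [← Real.rpow_mul hy0.le, neg_mul_neg, inv_mul_cancel₀ hk, Real.rpow_one] at this
    exact (mul_eq_left₀ hy0.ne').1 this

/-- A connected component of the part of `{h = 1}` lying in an open set is open in `{h = 1}`. -/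
lemma eventually_mem_connectedComponentIn {V : Set E} (hV : IsOpen V) {k : ℝ} (hk : k ≠ 0)
    {h : E → ℝ} (hsmooth : ContDiffOn ℝ (⊤ : ℕ∞) h V)
    (heuler : ∀ x ∈ V, fderiv ℝ h x x = k * h x) {U : Set E} (hU : IsOpen U) (hUV : U ⊆ V)
    {x₀ q : E} (hq : q ∈ connectedComponentIn {x ∈ U | h x = 1} x₀) :
    ∀ᶠ x in 𝓝 q, h x = 1 → x ∈ connectedComponentIn {x ∈ U | h x = 1} x₀ := by
  obtain ⟨hqU, hq1⟩ := connectedComponentIn_subset _ _ hq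
  obtain ⟨r, hr, hsm, hπ⟩ :=
    exists_ball_radialProj hV hk hsmooth heuler (hUV hqU) hq1 (hU.mem_nhds hqU)
  rw [connectedComponentIn_eq hq]
  have hsub : radialProj h k '' Metric.ball q r ⊆
      connectedComponentIn {x ∈ U | h x = 1} q := by
    refine IsPreconnected.subset_connectedComponentIn
      ((convex_ball q r).isPreconnected.image _ hsm.continuousOn)
      ⟨q, Metric.mem_ball_self hr, radialProj_of_eq_one hq1⟩ ?_
    rintro _ ⟨y, hy, rfl⟩
    exact ⟨(hπ y hy).2, (hπ y hy).1⟩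
  filter_upwards [Metric.ball_mem_nhds q hr] with x hx hx1
  exact hsub ⟨x, hx, radialProj_of_eq_one hx1⟩

end RadialProjection

section CurveLength

variable {E : Type*} [NormedAddCommGroup E] [NormedSpace ℝ E]

/-- The displacement along a smooth curve is at most its length. -/
lemma enorm_sub_le_lintegral_derivWithin [CompleteSpace E] {T : ℝ≥0∞} {γ : ℝ → E}
    (hγ : ContDiffOn ℝ (⊤ : ℕ∞) γ {t : ℝ | 0 ≤ t ∧ ENNReal.ofReal t < T})
    {t : ℝ} (ht0 : 0 ≤ t) (htT : ENNReal.ofReal t < T) :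
    ‖γ t - γ 0‖ₑ ≤ ∫⁻ s in {t : ℝ | 0 ≤ t ∧ ENNReal.ofReal t < T},
      ENNReal.ofReal ‖derivWithin γ {t : ℝ | 0 ≤ t ∧ ENNReal.ofReal t < T} s‖ := by
  set I : Set ℝ := {t : ℝ | 0 ≤ t ∧ ENNReal.ofReal t < T} with hI
  have hIU : UniqueDiffOn ℝ I :=
    (uniqueDiffOn_Ici (0 : ℝ)).inter (isOpen_Iio.preimage ENNReal.continuous_ofReal)
  have hsub : Icc 0 t ⊆ I := fun s hs =>
    ⟨hs.1, (ENNReal.ofReal_le_ofReal hs.2).trans_lt htT⟩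
  have hint : IntervalIntegrable (derivWithin γ I) volume 0 t := by
    apply ContinuousOn.intervalIntegrable
    rw [uIcc_of_le ht0]
    exact (hγ.continuousOn_derivWithin hIU (by simp)).mono hsub
  rw [← intervalIntegral.integral_eq_sub_of_hasDerivAt_of_le ht0 (hγ.continuousOn.mono hsub)
    (fun x hx => ((hγ.differentiableOn (by simp) x
      (hsub (Ioo_subset_Icc_self hx))).hasDerivWithinAt).hasDerivAt
      (mem_of_superset (Ioo_mem_nhds hx.1 hx.2) (Ioo_subset_Icc_self.trans hsub))) hint,
    intervalIntegral.integral_of_le ht0]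
  refine (enorm_integral_le_lintegral_enorm _).trans ?_
  simp only [ofReal_norm]
  exact lintegral_mono_set (Ioc_subset_Icc_self.trans hsub)

/-- A curve that extends differentiably past the end of a bounded interval has finite
length there. -/
lemma lintegral_derivWithin_lt_top {c : ℝ → E} {S : Set ℝ} (hS : IsOpen S)
    (hc : ContDiffOn ℝ (⊤ : ℕ∞) c S) {T : ℝ} (hTS : Icc 0 T ⊆ S) :
    ∫⁻ t in Ico 0 T, ENNReal.ofReal ‖derivWithin c (Ico 0 T) t‖ < ⊤ := by
  obtain ⟨C, hC⟩ := isCompact_Icc.exists_bound_of_continuousOn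
    ((hc.continuousOn_deriv_of_isOpen hS (by simp)).mono hTS)
  refine setLIntegral_lt_top_of_le_nnreal (by simp) ⟨C.toNNReal, fun t ht => ?_⟩
  have htS := hTS (Ico_subset_Icc_self ht)
  rw [((hc.differentiableOn (by simp)).differentiableAt (hS.mem_nhds htS)).derivWithin
    (uniqueDiffOn_Ico 0 T t ht)]
  exact ENNReal.ofReal_le_ofReal (hC t (Ico_subset_Icc_self ht))

end CurveLength

/-- If `A` is open in the level set `{h = 1}` and `c` is a path in `{h = 1}` that starts in `A`
and ends outside, then `c` leaves `A` at a first time. -/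
lemma exists_first_exit {E : Type*} [TopologicalSpace E] {h : E → ℝ} {A : Set E}
    (hA : ∀ q ∈ A, ∀ᶠ x in 𝓝 q, h x = 1 → x ∈ A) {c : ℝ → E}
    (hc : ContinuousOn c (Icc 0 1)) (hc1 : ∀ t ∈ Icc (0 : ℝ) 1, h (c t) = 1)
    (h0 : c 0 ∈ A) (h1 : c 1 ∉ A) :
    ∃ T ∈ Ioc (0 : ℝ) 1, c T ∉ A ∧ ∀ t ∈ Ico 0 T, c t ∈ A := by
  have hS : {t ∈ Icc (0 : ℝ) 1 | c t ∉ A} =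
      Icc 0 1 ∩ c ⁻¹' {x | ∀ᶠ y in 𝓝 x, h y = 1 → y ∈ A}ᶜ := by
    ext t
    refine and_congr_right fun ht => not_congr ⟨hA _, fun hx => hx.self_of_nhds (hc1 t ht)⟩
  have hcl : IsClosed {t ∈ Icc (0 : ℝ) 1 | c t ∉ A} := by
    rw [hS]
    exact hc.preimage_isClosed_of_isClosed isClosed_Icc
      isOpen_setOfPred_eventually_nhds.isClosed_compl
  have hcpt := isCompact_Icc.of_isClosed_subset hcl (sep_subset _ _)
  obtain ⟨T, ⟨hT, hTA⟩, hmin⟩ := hcpt.exists_isLeast ⟨1, by simp, h1⟩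
  refine ⟨T, ⟨hT.1.lt_of_ne ?_, hT.2⟩, hTA, fun t ht => ?_⟩
  · rintro rfl
    exact hTA h0
  · by_contra hcon
    exact ht.2.not_ge (hmin ⟨⟨ht.1, ht.2.le.trans hT.2⟩, hcon⟩)

/-- With the hypotheses of Statement 9 (smooth `h` on an open set
`V`, Euler-homogeneous of degree `k ≠ 0`, `U ⊆ V` open with `closure H ⊆ V` for
`H = {x ∈ U | h x = 1}`, Hessian definite on the tangent spaces), a connected
component `H₀` of `H` is closed in `ℝ^{n+1}` if and only if it is Euclidean
complete, i.e. every smooth curve `γ : [0,T) → H₀` not contained in any compact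
subset of `H₀` has infinite Euclidean length. -/
theorem stmt_10 (n : ℕ)
    (V : Set (EuclideanSpace ℝ (Fin (n + 1)))) (hVopen : IsOpen V)
    (k : ℝ) (hk : k ≠ 0)
    (h : EuclideanSpace ℝ (Fin (n + 1)) → ℝ)
    (hsmooth : ContDiffOn ℝ (⊤ : ℕ∞) h V)
    (heuler : ∀ x ∈ V, fderiv ℝ h x x = k * h x)
    (U : Set (EuclideanSpace ℝ (Fin (n + 1)))) (hUopen : IsOpen U) (hUV : U ⊆ V)
    (H : Set (EuclideanSpace ℝ (Fin (n + 1))))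
    (hHdef : H = {x ∈ U | h x = 1})
    (hclos : closure H ⊆ V)
    (hdefinite : ∀ p ∈ H,
      (∀ v : EuclideanSpace ℝ (Fin (n + 1)),
        fderiv ℝ h p v = 0 → v ≠ 0 → 0 < fderiv ℝ (fderiv ℝ h) p v v) ∨
      (∀ v : EuclideanSpace ℝ (Fin (n + 1)),
        fderiv ℝ h p v = 0 → v ≠ 0 → fderiv ℝ (fderiv ℝ h) p v v < 0))
    (H₀ : Set (EuclideanSpace ℝ (Fin (n + 1))))
    (x₀ : EuclideanSpace ℝ (Fin (n + 1))) (hx₀ : x₀ ∈ H)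
    (hH₀ : H₀ = connectedComponentIn H x₀) :
    IsClosed H₀ ↔
      ∀ T : ℝ≥0∞, 0 < T →
        ∀ γ : ℝ → EuclideanSpace ℝ (Fin (n + 1)),
          ContDiffOn ℝ (⊤ : ℕ∞) γ {t : ℝ | 0 ≤ t ∧ ENNReal.ofReal t < T} →
          (∀ t, 0 ≤ t → ENNReal.ofReal t < T → γ t ∈ H₀) →
          (¬ ∃ K : Set (EuclideanSpace ℝ (Fin (n + 1))), IsCompact K ∧ K ⊆ H₀ ∧
            γ '' {t : ℝ | 0 ≤ t ∧ ENNReal.ofReal t < T} ⊆ K) →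
          ∫⁻ t in {t : ℝ | 0 ≤ t ∧ ENNReal.ofReal t < T},
            ENNReal.ofReal
              ‖derivWithin γ {t : ℝ | 0 ≤ t ∧ ENNReal.ofReal t < T} t‖ = ⊤ := by
  have hH₀H : H₀ ⊆ H := hH₀ ▸ connectedComponentIn_subset _ _
  constructor
  · intro hcl T hT γ hγ hmem hnc
    by_contra hlen
    refine hnc ⟨_, (isCompact_closedBall (γ 0) (∫⁻ t in {t : ℝ | 0 ≤ t ∧ ENNReal.ofReal t < T},
      ENNReal.ofReal ‖derivWithin γ {t : ℝ | 0 ≤ t ∧ ENNReal.ofReal t < T} t‖).toReal).inter_left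
        hcl, inter_subset_left, ?_⟩
    rintro _ ⟨t, ⟨ht0, htT⟩, rfl⟩
    refine ⟨hmem t ht0 htT, ?_⟩
    rw [Metric.mem_closedBall, dist_eq_norm, ← toReal_enorm]
    exact ENNReal.toReal_mono hlen (enorm_sub_le_lintegral_derivWithin hγ ht0 htT)
  · intro hcomplete
    refine isClosed_of_closure_subset fun p hp => ?_
    have hpV : p ∈ V := hclos (closure_mono hH₀H hp)
    have hH1 : ∀ x ∈ H₀, h x = 1 := fun x hx => by
      have := hH₀H hx
      rw [hHdef] at this
      exact this.2
    have hp1 : h p = 1 := by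
      have hcont : ContinuousAt h p := hsmooth.continuousOn.continuousAt (hVopen.mem_nhds hpV)
      have := hcont.continuousWithinAt.mem_closure_image hp
      simpa using closure_mono (image_subset_iff.2 hH1 : h '' H₀ ⊆ {1}) this
    obtain ⟨r, hr, hsm, hπ⟩ :=
      exists_ball_radialProj hVopen hk hsmooth heuler hpV hp1 univ_mem
    obtain ⟨q, hqH, hqp⟩ := Metric.mem_closure_iff.1 hp r hr
    by_contra hpH
    set c : ℝ → EuclideanSpace ℝ (Fin (n + 1)) :=
      fun t => radialProj h k (AffineMap.lineMap q p t) with hc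
    set S : Set ℝ := (fun t : ℝ => AffineMap.lineMap q p t) ⁻¹' Metric.ball p r with hSdef
    have hline : ContDiff ℝ (⊤ : ℕ∞)
        (fun t : ℝ => (AffineMap.lineMap q p t : EuclideanSpace ℝ (Fin (n + 1)))) := by
      simp only [AffineMap.lineMap_apply_module]
      fun_prop
    have hSo : IsOpen S := Metric.isOpen_ball.preimage hline.continuous
    have hcS : ContDiffOn ℝ (⊤ : ℕ∞) c S := hsm.comp hline.contDiffOn fun t ht => ht
    have hSI : Icc (0 : ℝ) 1 ⊆ S := fun t ht =>
      (convex_ball p r).lineMap_mem (by rwa [Metric.mem_ball, dist_comm])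
        (Metric.mem_ball_self hr) ht
    have hopen : ∀ x ∈ H₀, ∀ᶠ y in 𝓝 x, h y = 1 → y ∈ H₀ := by
      subst hH₀ hHdef
      exact fun x hx => eventually_mem_connectedComponentIn hVopen hk hsmooth heuler hUopen hUV hx
    obtain ⟨T, hT, hTH, hlt⟩ := exists_first_exit hopen (hcS.continuousOn.mono hSI)
      (fun t ht => (hπ _ (hSI ht)).1)
      (by simpa [hc, radialProj_of_eq_one (hH1 q hqH)] using hqH)
      (by simpa [hc, radialProj_of_eq_one hp1] using hpH)
    have hI : {t : ℝ | 0 ≤ t ∧ ENNReal.ofReal t < ENNReal.ofReal T} = Ico 0 T := by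
      ext t
      simp [ENNReal.ofReal_lt_ofReal_iff hT.1]
    have hTS : Icc 0 T ⊆ S := (Icc_subset_Icc_right hT.2).trans hSI
    have hlen := hcomplete (ENNReal.ofReal T) (by simpa using hT.1) c
    rw [hI] at hlen
    refine (lintegral_derivWithin_lt_top hSo hcS hTS).ne
      (hlen (hcS.mono (Ico_subset_Icc_self.trans hTS)) (fun t ht0 htT => ?_) ?_)
    · exact hlt t (hI ▸ ⟨ht0, htT⟩)
    · rintro ⟨K, hK, hKH, hcK⟩
      have hTc : ContinuousWithinAt c (Ico 0 T) T :=
        (hcS.continuousOn.continuousAt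
          (hSo.mem_nhds (hTS (right_mem_Icc.2 hT.1.le)))).continuousWithinAt
      have hTcl : T ∈ closure (Ico 0 T) := by
        rw [closure_Ico hT.1.ne]
        exact right_mem_Icc.2 hT.1.le
      exact hTH (hKH (hK.isClosed.closure_subset_iff.2 hcK (hTc.mem_closure_image hTcl)))
end

section
/- Let V ⊆ ℝ^{n+1} be an open cone, k > 1, and h : V → ℝ a smooth function positively homogeneous of degree k. Let H be a connected component of {x ∈ V : h(x) = 1} that is a closed subset of ℝ^{n+1}, with D²h_p negative definite on ker Dh_p for every p ∈ H; set U := {λx : λ > 0, x ∈ H} and extend h to U by h(λx) := λ^k for x ∈ H, λ > 0. Then for every x ∈ U the symmetric bilinear form g_L := −(1/k)·D²h_x on ℝ^{n+1} is a Lorentzian scalar product of signature (n, 1): one has D²h_x(x, x) = k(k−1)·h(x) > 0 (so g_L(x, x) < 0), g_L is positive definite on the hyperplane ker Dh_x, the decomposition ℝ^{n+1} = ℝ·x ⊕ ker Dh_x holds, and D²h_x(x, v) = (k−1)·Dh_x(v) for all v, so this decomposition is g_L-orthogonal. -/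
open Set

section Homogeneous

variable {E F : Type*} [NormedAddCommGroup E] [NormedSpace ℝ E]
  [NormedAddCommGroup F] [NormedSpace ℝ F]

/-- Euler's identity for a function that is positively homogeneous along the ray through `x`. -/
lemma fderiv_apply_self_of_homogeneous {f : E → F} {k : ℝ} {x : E}
    (hom : ∀ l : ℝ, 0 < l → f (l • x) = l ^ k • f x) (hf : DifferentiableAt ℝ f x) :
    fderiv ℝ f x x = k • f x := by
  have hsmul : HasDerivAt (fun l : ℝ => l • x) x 1 := by
    simpa using (hasDerivAt_id (1 : ℝ)).smul_const x
  have hchain : HasDerivAt (fun l : ℝ => f (l • x)) (fderiv ℝ f x x) 1 := by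
    have hf' : HasFDerivAt f (fderiv ℝ f x) ((1 : ℝ) • x) := by
      simpa using hf.hasFDerivAt
    exact hf'.comp_hasDerivAt (1 : ℝ) hsmul
  have hpow : HasDerivAt (fun l : ℝ => l ^ k • f x) (k • f x) 1 := by
    simpa using
      (Real.hasDerivAt_rpow_const (x := 1) (p := k) (Or.inl one_ne_zero)).smul_const (f x)
  refine hchain.unique (hpow.congr_of_eventuallyEq ?_)
  filter_upwards [lt_mem_nhds (zero_lt_one (α := ℝ))] with l hl using hom l hl

/-- The derivative of a function positively homogeneous of degree `k` on an open set is
positively homogeneous of degree `k - 1`. -/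
lemma fderiv_smul_of_homogeneous {f : E → F} {V : Set E} {k : ℝ} (hV : IsOpen V)
    (hom : ∀ l : ℝ, 0 < l → ∀ x ∈ V, f (l • x) = l ^ k • f x)
    {l : ℝ} (hl : 0 < l) {x : E} (hx : x ∈ V) (hf : DifferentiableAt ℝ f x) :
    fderiv ℝ f (l • x) = l ^ (k - 1) • fderiv ℝ f x := by
  have heq : (fun y => f (l • y)) =ᶠ[nhds x] fun y => l ^ k • f y := by
    filter_upwards [hV.mem_nhds hx] with y hy using hom l hl y hy
  have hder : l • fderiv ℝ f (l • x) = l ^ k • fderiv ℝ f x := by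
    rw [← fderiv_comp_smul, heq.fderiv_eq, fderiv_fun_const_smul hf]
  rw [Real.rpow_sub_one hl.ne', div_eq_inv_mul, mul_smul, ← hder, inv_smul_smul₀ hl.ne']

end Homogeneous

/-- For a closed connected hyperbolic component `H` of the level set
`{h = 1}` of a smooth positively homogeneous function of degree `k > 1` on an open
cone `V`, at each point `x` of the cone `U = ℝ^{>0}·H` the form
`g_L = −(1/k)·D²h_x` is Lorentzian of signature `(n,1)`:
`D²h_x(x,x) = k(k−1)h(x) > 0` (so `g_L(x,x) < 0`), `g_L` is positive definite on
the hyperplane `ker Dh_x`, every vector decomposes uniquely as `a·x + v` with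
`v ∈ ker Dh_x`, and `D²h_x(x,·) = (k−1)·Dh_x`, so the decomposition is
`g_L`-orthogonal. -/
theorem stmt_11 (n : ℕ)
    (V : Set (EuclideanSpace ℝ (Fin (n + 1)))) (hVopen : IsOpen V)
    (hVcone : ∀ l : ℝ, 0 < l → ∀ x ∈ V, l • x ∈ V)
    (k : ℝ) (hk : 1 < k)
    (h : EuclideanSpace ℝ (Fin (n + 1)) → ℝ)
    (hsmooth : ContDiffOn ℝ (⊤ : ℕ∞) h V)
    (hhomog : ∀ l : ℝ, 0 < l → ∀ x ∈ V, h (l • x) = l ^ k * h x)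
    (H : Set (EuclideanSpace ℝ (Fin (n + 1))))
    (x₀ : EuclideanSpace ℝ (Fin (n + 1))) (hx₀V : x₀ ∈ V) (hx₀1 : h x₀ = 1)
    (hH : H = connectedComponentIn {x ∈ V | h x = 1} x₀)
    (hHclosed : IsClosed H)
    (hhyp : ∀ p ∈ H, ∀ v : EuclideanSpace ℝ (Fin (n + 1)),
      fderiv ℝ h p v = 0 → v ≠ 0 → fderiv ℝ (fderiv ℝ h) p v v < 0)
    (U : Set (EuclideanSpace ℝ (Fin (n + 1))))
    (hU : U = {y | ∃ l : ℝ, 0 < l ∧ ∃ x ∈ H, y = l • x}) :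
    ∀ x ∈ U,
      (fderiv ℝ (fderiv ℝ h) x x x = k * (k - 1) * h x ∧ 0 < h x ∧
        -(1 / k) * fderiv ℝ (fderiv ℝ h) x x x < 0) ∧
      (∀ v : EuclideanSpace ℝ (Fin (n + 1)), fderiv ℝ h x v = 0 → v ≠ 0 →
        0 < -(1 / k) * fderiv ℝ (fderiv ℝ h) x v v) ∧
      (∀ y : EuclideanSpace ℝ (Fin (n + 1)),
        ∃! av : ℝ × EuclideanSpace ℝ (Fin (n + 1)),
          fderiv ℝ h x av.2 = 0 ∧ y = av.1 • x + av.2) ∧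
      (∀ v : EuclideanSpace ℝ (Fin (n + 1)),
        fderiv ℝ (fderiv ℝ h) x x v = (k - 1) * fderiv ℝ h x v) := by
  have hHV : ∀ p ∈ H, p ∈ V ∧ h p = 1 := fun p hp =>
    connectedComponentIn_subset {x ∈ V | h x = 1} x₀ (hH ▸ hp)
  have hdiff : ∀ y ∈ V, DifferentiableAt ℝ h y := fun y hy =>
    (hsmooth.contDiffAt (hVopen.mem_nhds hy)).differentiableAt (by simp)
  have hdiff' : ∀ y ∈ V, DifferentiableAt ℝ (fderiv ℝ h) y := fun y hy =>
    ((hsmooth.contDiffAt (hVopen.mem_nhds hy)).fderiv_right (m := 1)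
      (WithTop.coe_le_coe.mpr (le_top : (1 + 1 : ℕ∞) ≤ ⊤))).differentiableAt (by simp)
  have hhomog' : ∀ l : ℝ, 0 < l → ∀ y ∈ V,
      fderiv ℝ h (l • y) = l ^ (k - 1) • fderiv ℝ h y := fun l hl y hy =>
    fderiv_smul_of_homogeneous hVopen hhomog hl hy (hdiff y hy)
  intro x hx
  rw [hU] at hx
  obtain ⟨l, hl, p, hp, rfl⟩ := hx
  obtain ⟨hpV, hp1⟩ := hHV p hp
  have hV : l • p ∈ V := hVcone l hl p hpV
  have hpos : 0 < h (l • p) := by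
    rw [hhomog l hl p hpV, hp1, mul_one]
    exact Real.rpow_pos_of_pos hl k
  have hess_smul : fderiv ℝ (fderiv ℝ h) (l • p) =
      l ^ (k - 1 - 1) • fderiv ℝ (fderiv ℝ h) p :=
    fderiv_smul_of_homogeneous hVopen hhomog' hl hpV (hdiff' p hpV)
  have hneg : ∀ v, fderiv ℝ h (l • p) v = 0 → v ≠ 0 →
      fderiv ℝ (fderiv ℝ h) (l • p) v v < 0 := by
    intro v hv hv0
    rw [hhomog' l hl p hpV, smul_apply, smul_eq_mul] at hv
    have hv' := (mul_eq_zero.mp hv).resolve_left (Real.rpow_pos_of_pos hl _).ne'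
    rw [hess_smul, smul_apply, smul_apply, smul_eq_mul]
    exact mul_neg_of_pos_of_neg (Real.rpow_pos_of_pos hl _) (hhyp p hp v hv' hv0)
  generalize l • p = x at *
  have euler : fderiv ℝ h x x = k * h x :=
    fderiv_apply_self_of_homogeneous (fun t ht => hhomog t ht x hV) (hdiff x hV)
  have euler' : ∀ v, fderiv ℝ (fderiv ℝ h) x x v = (k - 1) * fderiv ℝ h x v := by
    intro v
    rw [fderiv_apply_self_of_homogeneous (fun t ht => hhomog' t ht x hV) (hdiff' x hV),
      smul_apply, smul_eq_mul]
  have hk0 : 0 < k := one_pos.trans hk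
  have hess_self : fderiv ℝ (fderiv ℝ h) x x x = k * (k - 1) * h x := by
    rw [euler', euler]
    ring
  have hcoef : -(1 / k) < 0 := neg_neg_of_pos (one_div_pos.mpr hk0)
  refine ⟨⟨hess_self, hpos, ?_⟩, ?_, ?_, euler'⟩
  · rw [hess_self]
    exact mul_neg_of_neg_of_pos hcoef (mul_pos (mul_pos hk0 (sub_pos.mpr hk)) hpos)
  · exact fun v hv hv0 => mul_pos_of_neg_of_neg hcoef (hneg v hv hv0)
  · intro y
    have hne : fderiv ℝ h x x ≠ 0 := by
      rw [euler]
      exact (mul_pos hk0 hpos).ne'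
    refine ⟨(fderiv ℝ h x y / fderiv ℝ h x x, y - (fderiv ℝ h x y / fderiv ℝ h x x) • x),
      ⟨?_, ?_⟩, ?_⟩
    · simp [hne]
    · simp
    · rintro ⟨a, v⟩ ⟨hv, rfl⟩
      have hv' : fderiv ℝ h x v = 0 := hv
      simp [hv', hne]
end
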